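/- Let α ∈ (0,1) and define E_{α,α}(x) := ∑_{k=0}^∞ x^k · (Γ(α k + α))⁻¹ for x ∈ ℝ. Then there exists C > 0 such that |E_{α,α}(τ)| ≤ C τ^{-2} for every τ ≤ -1. -/

import Mathlib

open Real

open MeasureTheory Filter Topology Complex FourierTransform

lemma integral_rpow_mul_cexp_neg_mul_Ioi {a : ℝ} (ha : 0 < a) {r : ℂ} (hr : 0 < r.re) :
    ∫ t in Set.Ioi (0 : ℝ), ((t ^ (a - 1) : ℝ) : ℂ) * cexp (-(r * t)) =
      (1 / r) ^ (a : ℂ) * (Real.Gamma a : ℂ) := by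
  set μ : Measure ℝ := (volume.restrict (Set.Ioi 0)).withDensity
    fun t ↦ ((t ^ (a - 1)).toNNReal : ENNReal) with hμ
  have hmeas : Measurable fun t : ℝ ↦ (t ^ (a - 1)).toNNReal := by fun_prop
  have hmgf (ζ : ℂ) : ProbabilityTheory.complexMGF id μ ζ =
      ∫ t in Set.Ioi (0 : ℝ), ((t ^ (a - 1) : ℝ) : ℂ) * cexp (ζ * t) := by
    rw [ProbabilityTheory.complexMGF, hμ, integral_withDensity_eq_integral_smul hmeas]
    refine setIntegral_congr_fun measurableSet_Ioi fun t ht ↦ ?_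
    have : 0 ≤ t ^ (a - 1) := rpow_nonneg (le_of_lt ht) _
    simp [NNReal.smul_def, this]
  have hsub : Set.Iio 0 ⊆ interior (ProbabilityTheory.integrableExpSet id μ) := by
    refine interior_maximal (fun x hx ↦ ?_) isOpen_Iio
    rw [ProbabilityTheory.integrableExpSet, Set.mem_ofPred_eq, hμ,
      integrable_withDensity_iff_integrable_smul hmeas]
    refine IntegrableOn.congr_fun (f := fun t ↦ t ^ (a - 1) * rexp (- (-x) * t ^ (1 : ℝ)))
      (integrableOn_rpow_mul_exp_neg_mul_rpow (by linarith) one_pos (by simpa using hx))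
      (fun t ht ↦ ?_) measurableSet_Ioi
    have : 0 ≤ t ^ (a - 1) := rpow_nonneg (le_of_lt ht) _
    simp [NNReal.smul_def, this]
  have hU : IsOpen {ζ : ℂ | ζ.re < 0} := isOpen_lt continuous_re continuous_const
  have hf : AnalyticOnNhd ℂ (ProbabilityTheory.complexMGF id μ) {ζ | ζ.re < 0} :=
    ProbabilityTheory.analyticOnNhd_complexMGF.mono fun ζ hζ ↦ hsub hζ
  have hg : AnalyticOnNhd ℂ (fun ζ : ℂ ↦ (1 / (-ζ)) ^ (a : ℂ) * (Real.Gamma a : ℂ))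
      {ζ | ζ.re < 0} := by
    refine DifferentiableOn.analyticOnNhd (fun ζ hζ ↦ ?_) hU
    have h0 : -ζ ≠ 0 := by
      intro h
      have := congrArg re h
      simp at this hζ
      linarith
    have h1 : 1 / (-ζ) ∈ slitPlane := by
      rw [one_div]
      refine mem_slitPlane_iff.2 (Or.inl ?_)
      rw [inv_re]
      have : 0 < normSq (-ζ) := normSq_pos.2 h0
      exact div_pos (by simpa using hζ) this
    exact (((differentiableAt_const _).div differentiableAt_id.neg h0).cpow_const h1
      |>.mul_const _).differentiableWithinAt
  have hfreq : ∃ᶠ ζ in 𝓝[≠] (-1 : ℂ), ProbabilityTheory.complexMGF id μ ζ =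
      (1 / (-ζ)) ^ (a : ℂ) * (Real.Gamma a : ℂ) := by
    have ht : Tendsto (fun x : ℝ ↦ (x : ℂ)) (𝓝[≠] (-1 : ℝ)) (𝓝[≠] (-1 : ℂ)) := by
      refine tendsto_nhdsWithin_iff.2 ⟨?_, ?_⟩
      · have := (continuous_ofReal.tendsto (-1 : ℝ)).mono_left (nhdsWithin_le_nhds (s := {-1}ᶜ))
        simpa using this
      · filter_upwards [self_mem_nhdsWithin] with x hx
        simpa using fun h ↦ hx (by exact_mod_cast h)
    refine ht.frequently (Eventually.frequently ?_)
    filter_upwards [nhdsWithin_le_nhds (Iio_mem_nhds (show (-1 : ℝ) < 0 by norm_num))] with x hx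
    have hx : x < 0 := hx
    have := integral_cpow_mul_exp_neg_mul_Ioi (a := a) (r := -x) (by simpa) (by simpa)
    rw [hmgf, ← Complex.Gamma_ofReal, ← ofReal_neg, ← this]
    refine setIntegral_congr_fun measurableSet_Ioi fun t ht ↦ ?_
    simp [ofReal_cpow (le_of_lt ht)]
  have key := hf.eqOn_of_preconnected_of_frequently_eq hg
    (convex_halfSpace_re_lt 0).isPreconnected (z₀ := -1) (by simp) hfreq
  have := key (x := -r) (by simpa using hr)
  rw [hmgf] at this
  simpa using this

lemma norm_one_add_two_pi_mul_I (w : ℝ) :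
    ‖(1 + 2 * π * w * I : ℂ)‖ = (1 + ‖2 * π * w‖ ^ 2) ^ (1 / 2 : ℝ) := by
  have : (1 + 2 * π * w * I : ℂ) = (1 : ℝ) + (2 * π * w : ℝ) * I := by push_cast; ring
  rw [this, norm_add_mul_I, sqrt_eq_rpow, norm_eq_abs, sq_abs, one_pow]

lemma one_le_norm_one_add_two_pi_mul_I (w : ℝ) : 1 ≤ ‖(1 + 2 * π * w * I : ℂ)‖ := by
  simpa using abs_re_le_norm (1 + 2 * π * w * I : ℂ)

lemma integrable_norm_rpow_vertical {p : ℝ} (hp : p < -1) :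
    Integrable fun w : ℝ ↦ ‖(1 + 2 * π * w * I : ℂ)‖ ^ p := by
  have h := (integrable_rpow_neg_one_add_norm_sq (E := ℝ) (μ := volume) (r := -p)
    (by simp; linarith)).comp_mul_left' (R := 2 * π) (by positivity)
  refine h.congr (ae_of_all _ fun w ↦ ?_)
  simp only [norm_one_add_two_pi_mul_I]
  rw [← rpow_mul (by positivity)]
  ring_nf

lemma continuous_one_div_vertical_cpow (z : ℂ) :
    Continuous fun w : ℝ ↦ (1 / (1 + 2 * π * w * I) : ℂ) ^ z := by
  have h0 (w : ℝ) : (1 + 2 * π * w * I : ℂ) ≠ 0 := fun h ↦ by simpa using congrArg re h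
  refine Continuous.cpow (continuous_const.div (by fun_prop) h0) continuous_const fun w ↦ ?_
  refine mem_slitPlane_iff.2 (Or.inl ?_)
  rw [one_div, inv_re]
  exact div_pos (by simp) (normSq_pos.2 (h0 w))

lemma norm_one_div_vertical_cpow (z w : ℝ) :
    ‖(1 / (1 + 2 * π * w * I) : ℂ) ^ (z : ℂ)‖ = ‖(1 + 2 * π * w * I : ℂ)‖ ^ (-z) := by
  rw [norm_cpow_real, norm_div, norm_one, one_div, inv_rpow (norm_nonneg _),
    rpow_neg (norm_nonneg _)]

/-- The inverse Laplace transform formula for the reciprocal Gamma function. -/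
lemma integral_cexp_mul_one_div_cpow_vertical {z : ℝ} (hz : 1 < z) :
    ∫ w : ℝ, cexp (1 + 2 * π * w * I) * (1 / (1 + 2 * π * w * I)) ^ (z : ℂ) =
      ((Real.Gamma z)⁻¹ : ℝ) := by
  set f : ℝ → ℂ := (Set.Ioi 0).indicator fun t ↦ ((rexp (-t) * t ^ (z - 1) : ℝ) : ℂ) with hf
  have hfi : Integrable f :=
    IntegrableOn.integrable_indicator (Real.GammaIntegral_convergent (by linarith)).ofReal
      measurableSet_Ioi
  have hF (w : ℝ) : 𝓕 f w = (1 / (1 + 2 * π * w * I)) ^ (z : ℂ) * (Real.Gamma z : ℂ) := by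
    rw [Real.fourier_real_eq_integral_exp_smul,
      ← integral_rpow_mul_cexp_neg_mul_Ioi (by linarith) (by simp),
      ← integral_indicator measurableSet_Ioi]
    congr 1
    ext t
    by_cases ht : t ∈ Set.Ioi (0 : ℝ)
    · simp only [hf, Set.indicator_of_mem ht, smul_eq_mul, ofReal_mul, ofReal_exp]
      rw [mul_left_comm, ← mul_assoc, mul_comm, mul_comm (cexp _), ← Complex.exp_add]
      congr 2
      push_cast
      ring
    · simp [hf, Set.indicator_of_notMem ht]
  have hFi : Integrable (𝓕 f) := by
    rw [show 𝓕 f = _ from funext hF]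
    refine Integrable.mul_const ?_ _
    refine (integrable_norm_rpow_vertical (p := -z) (by linarith)).mono'
      (continuous_one_div_vertical_cpow _).aestronglyMeasurable (ae_of_all _ fun w ↦ ?_)
    exact (norm_one_div_vertical_cpow z w).le
  have hc : ContinuousAt f 1 := by
    have : (fun t : ℝ ↦ ((rexp (-t) * t ^ (z - 1) : ℝ) : ℂ)) =ᶠ[𝓝 1] f := by
      filter_upwards [Ioi_mem_nhds one_pos] with t ht
      rw [hf, Set.indicator_of_mem ht]
    refine ContinuousAt.congr ?_ this
    refine continuous_ofReal.continuousAt.comp ?_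
    exact (by fun_prop : ContinuousAt (fun t : ℝ ↦ rexp (-t)) 1).mul
      (continuousAt_rpow_const _ _ (Or.inl one_ne_zero))
  have hinv := hfi.fourierInv_fourier_eq hFi hc
  have hG : (Real.Gamma z : ℂ) ≠ 0 := by
    exact_mod_cast (Real.Gamma_pos_of_pos (by linarith)).ne'
  rw [Real.fourierInv_eq'] at hinv
  have h1 : f 1 = cexp (-1) := by
    rw [hf, Set.indicator_of_mem (by simp)]
    simp
  rw [h1] at hinv
  have h2 : ∫ w : ℝ, cexp (1 + 2 * π * w * I) * (1 / (1 + 2 * π * w * I)) ^ (z : ℂ) =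
      ∫ w : ℝ, cexp 1 * (Real.Gamma z : ℂ)⁻¹ *
        (cexp (↑(2 * π * inner ℝ w 1) * I) • 𝓕 f w) := by
    congr 1
    ext w
    rw [hF, Complex.exp_add]
    simp
    field_simp
  rw [h2, integral_const_mul, hinv, mul_right_comm, ← Complex.exp_add]
  simp

lemma re_cpow_ofReal_pos {z : ℂ} (hz : 0 < z.re) {α : ℝ} (hα : |α| ≤ 1) :
    0 < (z ^ (α : ℂ)).re := by
  have h0 : z ≠ 0 := by rintro rfl; simp at hz
  have harg : |z.arg| < π / 2 := abs_arg_lt_pi_div_two_iff.2 (Or.inl hz)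
  rw [cpow_def_of_ne_zero h0, exp_re]
  refine mul_pos (Real.exp_pos _) (cos_pos_of_mem_Ioo (abs_lt.1 ?_))
  have : (log z * α).im = z.arg * α := by simp [log_im]
  rw [this, abs_mul]
  nlinarith [abs_nonneg z.arg]

lemma one_add_mul_eq_mul_inv_add {r : ℂ} (hr : r ≠ 0) (c : ℂ) : 1 + c * r = r * (r⁻¹ + c) := by
  field_simp

lemma le_norm_inv_add_of_re_pos {r : ℂ} (hr : 0 < r.re) (c : ℂ) : c.re ≤ ‖r⁻¹ + c‖ := by
  have h : 0 < (r⁻¹).re := by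
    rw [inv_re]
    exact div_pos hr (normSq_pos.2 (by rintro rfl; simp at hr))
  calc c.re ≤ (r⁻¹ + c).re := by rw [add_re]; linarith
    _ ≤ _ := re_le_norm _

lemma one_add_mul_ne_zero_of_re_pos {r c : ℂ} (hr : 0 < r.re) (hc : 0 < c.re) :
    1 + c * r ≠ 0 := by
  have h0 : r ≠ 0 := by rintro rfl; simp at hr
  rw [one_add_mul_eq_mul_inv_add h0]
  exact mul_ne_zero h0 (norm_pos_iff.1 (hc.trans_le (le_norm_inv_add_of_re_pos hr c)))

lemma norm_inv_one_add_mul_le {r c : ℂ} (hr : 0 < r.re) {δ : ℝ} (hδ : 0 < δ) (hc : δ ≤ c.re) :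
    ‖(1 + c * r)⁻¹‖ ≤ 1 + ‖c‖ / δ := by
  have h0 : r ≠ 0 := by rintro rfl; simp at hr
  have hle := hc.trans (le_norm_inv_add_of_re_pos hr c)
  have h1 : r⁻¹ + c ≠ 0 := norm_pos_iff.1 (hδ.trans_le hle)
  have : (1 + c * r)⁻¹ = 1 - c * (r⁻¹ + c)⁻¹ := by
    rw [eq_sub_iff_add_eq, one_add_mul_eq_mul_inv_add h0, mul_inv, ← add_mul,
      mul_inv_cancel₀ h1]
  rw [this]
  refine (norm_sub_le _ _).trans ?_
  rw [norm_one, norm_mul, norm_inv, ← div_eq_mul_inv]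
  gcongr

lemma one_le_norm_one_add_ofReal_mul {r : ℂ} (hr : 0 < r.re) {c : ℝ} (hc : 0 ≤ c) :
    1 ≤ ‖1 + c * r‖ := by
  calc 1 ≤ (1 + c * r).re := by simp; positivity
    _ ≤ _ := re_le_norm _

lemma mul_norm_le_norm_one_add_ofReal_mul {r : ℂ} (hr : 0 < r.re) (c : ℝ) :
    c * ‖r‖ ≤ ‖1 + c * r‖ := by
  have h0 : r ≠ 0 := by rintro rfl; simp at hr
  rw [one_add_mul_eq_mul_inv_add h0, norm_mul, mul_comm]
  gcongr
  simpa using le_norm_inv_add_of_re_pos hr c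

lemma hasSum_mul_add_one_mul_geometric (a : ℂ) {q : ℂ} (hq : ‖q‖ < 1) :
    HasSum (fun k : ℕ ↦ a * (k + 1) * (a * (k + 1) + 1) * q ^ k)
      (a * (1 - a) / (1 - q) ^ 2 + 2 * a ^ 2 / (1 - q) ^ 3) := by
  have h1 := (hasSum_choose_mul_geometric_of_norm_lt_one 1 hq).mul_left (a * (1 - a))
  have h2 := (hasSum_choose_mul_geometric_of_norm_lt_one 2 hq).mul_left (2 * a ^ 2)
  convert! h1.add h2 using 1
  · ext k
    rw [Nat.cast_choose_two, Nat.choose_one_right]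
    push_cast
    ring
  · ring

/-- The factor `(1 / s) ^ α` along the vertical line `s = 1 + 2πiw`. -/
noncomputable def verticalCpow (α w : ℝ) : ℂ := (1 / (1 + 2 * π * w * I)) ^ (α : ℂ)

/-- The integrand `exp s` times the second derivative of `g`, along the line `s = 1 + 2πiw`,
where `g s = 1 / (s ^ α + c)`. -/
noncomputable def mittagLefflerKernel (α : ℝ) (c : ℂ) (w : ℝ) : ℂ :=
  cexp (1 + 2 * π * w * I) * (1 / (1 + 2 * π * w * I)) ^ 2 *
    (verticalCpow α w * (α * (1 - α) * ((1 + c * verticalCpow α w)⁻¹) ^ 2 +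
      2 * α ^ 2 * ((1 + c * verticalCpow α w)⁻¹) ^ 3))

lemma continuous_verticalCpow (α : ℝ) : Continuous (verticalCpow α) :=
  continuous_one_div_vertical_cpow α

lemma norm_verticalCpow (α w : ℝ) :
    ‖verticalCpow α w‖ = ‖(1 + 2 * π * w * I : ℂ)‖ ^ (-α) :=
  norm_one_div_vertical_cpow α w

lemma norm_verticalCpow_le_one {α : ℝ} (hα : 0 ≤ α) (w : ℝ) : ‖verticalCpow α w‖ ≤ 1 := by
  rw [norm_verticalCpow]
  exact rpow_le_one_of_one_le_of_nonpos (one_le_norm_one_add_two_pi_mul_I w) (by linarith)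

lemma re_verticalCpow_pos {α : ℝ} (hα : |α| ≤ 1) (w : ℝ) : 0 < (verticalCpow α w).re := by
  refine re_cpow_ofReal_pos ?_ hα
  rw [one_div, inv_re]
  exact div_pos (by simp) (normSq_pos.2 fun h ↦ by simpa using congrArg re h)

lemma norm_cexp_mul_vertical_sq (w : ℝ) :
    ‖cexp (1 + 2 * π * w * I) * (1 / (1 + 2 * π * w * I)) ^ 2‖ =
      rexp 1 * ‖(1 + 2 * π * w * I : ℂ)‖ ^ (-2 : ℝ) := by
  rw [norm_mul, norm_exp, norm_pow, norm_div, norm_one, one_div, inv_pow, rpow_neg (norm_nonneg _)]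
  simp

lemma measurable_mittagLefflerKernel (α : ℝ) (c : ℂ) : Measurable (mittagLefflerKernel α c) := by
  have := (continuous_verticalCpow α).measurable
  unfold mittagLefflerKernel
  fun_prop

lemma hasDerivAt_mittagLefflerKernel {α : ℝ} (hα : |α| ≤ 1) (w : ℝ) {c : ℂ} (hc : 0 < c.re) :
    HasDerivAt (fun c ↦ mittagLefflerKernel α c w)
      (cexp (1 + 2 * π * w * I) * (1 / (1 + 2 * π * w * I)) ^ 2 *
        (-(verticalCpow α w) ^ 2 * (2 * α * (1 - α) * ((1 + c * verticalCpow α w)⁻¹) ^ 3 +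
          6 * α ^ 2 * ((1 + c * verticalCpow α w)⁻¹) ^ 4))) c := by
  have h0 := one_add_mul_ne_zero_of_re_pos (re_verticalCpow_pos hα w) hc
  have h1 : HasDerivAt (fun c ↦ (1 + c * verticalCpow α w)⁻¹)
      (-verticalCpow α w * ((1 + c * verticalCpow α w)⁻¹) ^ 2) c := by
    convert! (((hasDerivAt_id c).mul_const (verticalCpow α w)).const_add 1).inv h0 using 1
    simp [div_eq_mul_inv]
  unfold mittagLefflerKernel
  convert! ((((h1.pow 2).const_mul (α * (1 - α) : ℂ)).add
    ((h1.pow 3).const_mul (2 * α ^ 2 : ℂ))).const_mul (verticalCpow α w)).const_mul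
      (cexp (1 + 2 * π * w * I) * (1 / (1 + 2 * π * w * I)) ^ 2) using 1
  push_cast
  ring

lemma norm_mittagLefflerKernel_le {α : ℝ} (hα : α ∈ Set.Icc (0 : ℝ) 1) (w : ℝ) {c : ℝ}
    (hc : 0 < c) :
    ‖mittagLefflerKernel α c w‖ ≤
      rexp 1 * (α * (1 - α) + 2 * α ^ 2) * ‖(1 + 2 * π * w * I : ℂ)‖ ^ (α - 2) / c ^ 2 := by
  obtain ⟨h0, h1⟩ := hα
  have hre := re_verticalCpow_pos (α := α) (by rwa [abs_of_nonneg h0]) w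
  have hone := one_le_norm_one_add_ofReal_mul hre hc.le
  have hmul := mul_norm_le_norm_one_add_ofReal_mul hre c
  have hr : 0 < ‖verticalCpow α w‖ := norm_pos_iff.2 (by rintro h; simp [h] at hre)
  have hs : 0 < ‖(1 + 2 * π * w * I : ℂ)‖ := one_pos.trans_le (one_le_norm_one_add_two_pi_mul_I w)
  set r := verticalCpow α w
  have hr' : ‖r‖⁻¹ = ‖(1 + 2 * π * w * I : ℂ)‖ ^ α := by
    rw [norm_verticalCpow, rpow_neg (norm_nonneg _), inv_inv]
  have hsq : ‖(1 + c * r)⁻¹‖ ^ 2 ≤ (c * ‖r‖)⁻¹ ^ 2 := by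
    rw [norm_inv]
    gcongr
  have hinv : ‖(1 + c * r)⁻¹‖ ≤ 1 := by
    rw [norm_inv]
    exact inv_le_one_of_one_le₀ hone
  have hbr : ‖(α * (1 - α) * ((1 + c * r)⁻¹) ^ 2 + 2 * α ^ 2 * ((1 + c * r)⁻¹) ^ 3 : ℂ)‖ ≤
      (α * (1 - α) + 2 * α ^ 2) * (c * ‖r‖)⁻¹ ^ 2 := by
    have e1 : ‖(α * (1 - α) : ℂ)‖ = α * (1 - α) := by
      rw [show (α * (1 - α) : ℂ) = ((α * (1 - α) : ℝ) : ℂ) by push_cast; ring, norm_real,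
        norm_of_nonneg (mul_nonneg h0 (by linarith))]
    have e2 : ‖(2 * α ^ 2 : ℂ)‖ = 2 * α ^ 2 := by simp
    refine (norm_add_le _ _).trans ?_
    rw [norm_mul, norm_mul (2 * _ : ℂ), e1, e2, norm_pow, norm_pow, add_mul]
    have := mul_nonneg h0 (sub_nonneg.2 h1)
    gcongr
    calc ‖(1 + c * r)⁻¹‖ ^ 3 ≤ ‖(1 + c * r)⁻¹‖ ^ 2 :=
          pow_le_pow_of_le_one (norm_nonneg _) hinv (by norm_num)
      _ ≤ _ := hsq
  rw [mittagLefflerKernel, norm_mul, norm_cexp_mul_vertical_sq, norm_mul]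
  calc _ ≤ rexp 1 * ‖(1 + 2 * π * w * I : ℂ)‖ ^ (-2 : ℝ) *
        (‖r‖ * ((α * (1 - α) + 2 * α ^ 2) * (c * ‖r‖)⁻¹ ^ 2)) := by gcongr
    _ = rexp 1 * (α * (1 - α) + 2 * α ^ 2) *
        (‖(1 + 2 * π * w * I : ℂ)‖ ^ (-2 : ℝ) * ‖r‖⁻¹) / c ^ 2 := by
      field_simp
    _ = _ := by rw [hr', ← rpow_add hs]; ring_nf

lemma integrable_mittagLefflerKernel {α : ℝ} (hα : α ∈ Set.Icc (0 : ℝ) 1) {c : ℂ} (hc : 0 < c.re) :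
    Integrable (mittagLefflerKernel α c) := by
  obtain ⟨h0, h1⟩ := hα
  set M := 1 + ‖c‖ / c.re
  refine ((integrable_norm_rpow_vertical (p := -2) (by norm_num)).const_mul
    (rexp 1 * (‖(α * (1 - α) : ℂ)‖ * M ^ 2 + ‖(2 * α ^ 2 : ℂ)‖ * M ^ 3))).mono'
    (measurable_mittagLefflerKernel α c).aestronglyMeasurable (ae_of_all _ fun w ↦ ?_)
  have hM := norm_inv_one_add_mul_le (re_verticalCpow_pos (α := α) (by rwa [abs_of_nonneg h0]) w)
    hc le_rfl
  rw [mittagLefflerKernel, norm_mul, norm_cexp_mul_vertical_sq, norm_mul, mul_right_comm]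
  gcongr
  refine (mul_le_of_le_one_left (norm_nonneg _) (norm_verticalCpow_le_one h0 w)).trans
    ((norm_add_le _ _).trans ?_)
  rw [norm_mul, norm_mul (2 * _ : ℂ), norm_pow, norm_pow]
  gcongr

lemma differentiableOn_integral_mittagLefflerKernel {α : ℝ} (hα : α ∈ Set.Icc (0 : ℝ) 1) :
    DifferentiableOn ℂ (fun c ↦ ∫ w, mittagLefflerKernel α c w) {c | 0 < c.re} := by
  intro c₀ hc₀
  have hc₀ : 0 < c₀.re := hc₀
  have h0 := hα.1
  have habs : |α| ≤ 1 := by rw [abs_of_nonneg h0]; exact hα.2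
  set δ := c₀.re / 2 with hδ
  have hδ0 : 0 < δ := by positivity
  set M := 1 + (‖c₀‖ + δ) / δ
  have hball {c : ℂ} (hc : c ∈ Metric.ball c₀ δ) : δ ≤ c.re ∧ ‖c‖ ≤ ‖c₀‖ + δ := by
    rw [Metric.mem_ball, dist_eq_norm] at hc
    have h1 := (abs_le.1 (abs_re_le_norm (c - c₀))).1
    have h2 := norm_le_norm_add_norm_sub' c c₀
    rw [sub_re] at h1
    exact ⟨by linarith, by linarith⟩
  have hmeas := (continuous_verticalCpow α).measurable
  refine (hasDerivAt_integral_of_dominated_loc_of_deriv_le (Metric.ball_mem_nhds c₀ hδ0)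
    (Eventually.of_forall fun c ↦ (measurable_mittagLefflerKernel α c).aestronglyMeasurable)
    (integrable_mittagLefflerKernel hα hc₀)
    (F' := fun c (w : ℝ) ↦ cexp (1 + 2 * π * w * I) * (1 / (1 + 2 * π * w * I)) ^ 2 *
        (-(verticalCpow α w) ^ 2 * (2 * α * (1 - α) * ((1 + c * verticalCpow α w)⁻¹) ^ 3 +
          6 * α ^ 2 * ((1 + c * verticalCpow α w)⁻¹) ^ 4)))
    (bound := fun (w : ℝ) ↦ rexp 1 * (‖(2 * α * (1 - α) : ℂ)‖ * M ^ 3 + ‖(6 * α ^ 2 : ℂ)‖ * M ^ 4) *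
      ‖(1 + 2 * π * w * I : ℂ)‖ ^ (-2 : ℝ))
    (Measurable.aestronglyMeasurable (by fun_prop)) (ae_of_all _ fun w c hc ↦ ?_)
    ((integrable_norm_rpow_vertical (p := -2) (by norm_num)).const_mul _)
    (ae_of_all _ fun w c hc ↦ hasDerivAt_mittagLefflerKernel habs w
      (hδ0.trans_le (hball hc).1))).2.differentiableAt.differentiableWithinAt
  have hM : ‖(1 + c * verticalCpow α w)⁻¹‖ ≤ M := by
    refine (norm_inv_one_add_mul_le (re_verticalCpow_pos habs w) hδ0 (hball hc).1).trans ?_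
    have := (hball hc).2
    exact add_le_add_right (div_le_div_of_nonneg_right this hδ0.le) 1
  rw [norm_mul, norm_cexp_mul_vertical_sq, norm_mul, mul_right_comm, norm_neg, norm_pow]
  gcongr
  refine (mul_le_of_le_one_left (norm_nonneg _)
    (pow_le_one₀ (norm_nonneg _) (norm_verticalCpow_le_one h0 w))).trans
    ((norm_add_le _ _).trans ?_)
  rw [norm_mul, norm_mul (6 * _ : ℂ), norm_pow, norm_pow]
  gcongr

lemma integral_mittagLefflerKernel_eq_tsum {α : ℝ} (hα : 0 < α) {c : ℂ} (hc : ‖c‖ < 1) :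
    ∫ w, mittagLefflerKernel α c w =
      ∑' k : ℕ, (-c) ^ k * (((Real.Gamma (α * k + α))⁻¹ : ℝ) : ℂ) := by
  set F : ℕ → ℝ → ℂ := fun k w ↦ (α * (k + 1) * (α * (k + 1) + 1) * (-c) ^ k) *
    (cexp (1 + 2 * π * w * I) * (1 / (1 + 2 * π * w * I)) ^ ((α * (k + 1) + 2 : ℝ) : ℂ)) with hF
  have hFeq (k : ℕ) (w : ℝ) : F k w = cexp (1 + 2 * π * w * I) * (1 / (1 + 2 * π * w * I)) ^ 2 *
      (verticalCpow α w * (α * (k + 1) * (α * (k + 1) + 1) * (-c * verticalCpow α w) ^ k)) := by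
    have h0 : (1 / (1 + 2 * π * w * I) : ℂ) ≠ 0 :=
      one_div_ne_zero fun h ↦ by simpa using congrArg re h
    have : (1 / (1 + 2 * π * w * I) : ℂ) ^ ((α * (k + 1) + 2 : ℝ) : ℂ) =
        verticalCpow α w ^ (k + 1) * (1 / (1 + 2 * π * w * I)) ^ 2 := by
      rw [verticalCpow, ← cpow_mul_nat, ofReal_add, cpow_add _ _ h0]
      push_cast
      norm_num
    simp only [hF, this]
    rw [mul_pow]
    ring
  have hsum (w : ℝ) : HasSum (fun k ↦ F k w) (mittagLefflerKernel α c w) := by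
    have hq : ‖-c * verticalCpow α w‖ < 1 := by
      rw [norm_mul, norm_neg]
      exact (mul_le_of_le_one_right (norm_nonneg _) (norm_verticalCpow_le_one hα.le w)).trans_lt hc
    have := ((hasSum_mul_add_one_mul_geometric α hq).mul_left (verticalCpow α w)).mul_left
      (cexp (1 + 2 * π * w * I) * (1 / (1 + 2 * π * w * I)) ^ 2)
    simp only [hFeq]
    convert! this using 1
    rw [mittagLefflerKernel, neg_mul, sub_neg_eq_add, inv_pow, inv_pow, div_eq_mul_inv (_ * _),
      div_eq_mul_inv (2 * _)]
  have hs2 := integrable_norm_rpow_vertical (p := -2) (by norm_num)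
  have hFmeas (k : ℕ) : AEStronglyMeasurable (F k) := by
    refine Continuous.aestronglyMeasurable (continuous_const.mul (Continuous.mul ?_ ?_))
    · fun_prop
    · exact continuous_one_div_vertical_cpow _
  have hFle (k : ℕ) (w : ℝ) : ‖F k w‖ ≤ ‖(α * (k + 1) * (α * (k + 1) + 1) * (-c) ^ k : ℂ)‖ *
      rexp 1 * ‖(1 + 2 * π * w * I : ℂ)‖ ^ (-2 : ℝ) := by
    have hexp : ‖cexp (1 + 2 * π * w * I)‖ = rexp 1 := by simp [norm_exp]
    simp only [hF]
    rw [norm_mul, norm_mul (cexp _), hexp, norm_one_div_vertical_cpow, mul_assoc _ (rexp 1)]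
    have : 0 < α * (k + 1) := by positivity
    gcongr
    · exact one_le_norm_one_add_two_pi_mul_I w
    · linarith
  have hFi (k : ℕ) : Integrable (F k) :=
    (hs2.const_mul _).mono' (hFmeas k) (ae_of_all _ (hFle k))
  have hFs : Summable fun k ↦ ∫ w, ‖F k w‖ := by
    have hcs := (hasSum_mul_add_one_mul_geometric α (q := -c) (by simpa)).summable.norm
    refine Summable.of_nonneg_of_le (fun k ↦ by positivity) (fun k ↦ ?_)
      ((hcs.mul_right (rexp 1)).mul_right (∫ w : ℝ, ‖(1 + 2 * π * w * I : ℂ)‖ ^ (-2 : ℝ)))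
    rw [← integral_const_mul]
    exact integral_mono (hFi k).norm (hs2.const_mul _) (hFle k)
  have key := (hasSum_integral_of_summable_integral_norm hFi hFs).tsum_eq
  simp only [fun w ↦ (hsum w).tsum_eq] at key
  rw [← key]
  congr 1
  ext k
  have hz : 0 < α * (k + 1) := by positivity
  simp only [hF]
  rw [integral_const_mul, integral_cexp_mul_one_div_cpow_vertical (by linarith),
    show α * k + α = α * (k + 1) by ring, show α * (k + 1 : ℝ) + 2 = α * (k + 1) + 1 + 1 by ring,
    Real.Gamma_add_one (by positivity), Real.Gamma_add_one hz.ne']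
  have hG : (Real.Gamma (α * (k + 1)) : ℂ) ≠ 0 := by
    exact_mod_cast (Real.Gamma_pos_of_pos hz).ne'
  have hz1 : (α * (k + 1) : ℂ) ≠ 0 := by exact_mod_cast hz.ne'
  have hz2 : (α * (k + 1) + 1 : ℂ) ≠ 0 := by exact_mod_cast (by positivity : α * (k + 1) + 1 ≠ 0)
  push_cast
  rw [mul_inv, mul_inv]
  have hα' : (α : ℂ) ≠ 0 := by exact_mod_cast hα.ne'
  field_simp

lemma rpow_mul_exp_neg_le_Gamma {R z : ℝ} (hR : 0 ≤ R) (hz : 1 ≤ z) :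
    R ^ (z - 1) * rexp (-R) ≤ Real.Gamma z := by
  have hint := Real.GammaIntegral_convergent (s := z) (by linarith)
  have hsub : Set.Ioi R ⊆ Set.Ioi 0 := Set.Ioi_subset_Ioi hR
  rw [Real.Gamma_eq_integral (by linarith), ← integral_exp_neg_Ioi, ← integral_const_mul]
  calc ∫ x in Set.Ioi R, R ^ (z - 1) * rexp (-x)
      ≤ ∫ x in Set.Ioi R, rexp (-x) * x ^ (z - 1) := by
        refine setIntegral_mono_on ((integrableOn_exp_neg_Ioi R).const_mul _) (hint.mono_set hsub)
          measurableSet_Ioi fun x hx ↦ ?_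
        rw [mul_comm]
        gcongr
        exact le_of_lt hx
    _ ≤ _ := by
        refine setIntegral_mono_set hint ?_ hsub.eventuallyLE
        filter_upwards [ae_restrict_mem measurableSet_Ioi] with x hx
        have : 0 ≤ x := le_of_lt hx
        simp only [Pi.zero_apply]
        positivity

lemma summable_pow_mul_inv_Gamma {α : ℝ} (hα : 0 < α) {ρ : ℝ} (hρ : 0 < ρ) :
    Summable fun k : ℕ ↦ ρ ^ k * (Real.Gamma (α * k + α))⁻¹ := by
  set R := (2 * ρ) ^ α⁻¹ with hR
  have hR0 : 0 < R := by positivity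
  have hRα : R ^ α = 2 * ρ := by
    rw [hR, ← rpow_mul (by positivity), inv_mul_cancel₀ hα.ne', rpow_one]
  have hgeo : Summable fun k : ℕ ↦ rexp R * R ^ (1 - α) * (1 / 2 : ℝ) ^ k :=
    summable_geometric_two.mul_left _
  refine Summable.of_norm_bounded_eventually_nat hgeo ?_
  have hlarge : ∀ᶠ k : ℕ in atTop, α⁻¹ ≤ k := tendsto_natCast_atTop_atTop.eventually_ge_atTop _
  filter_upwards [hlarge] with k hk
  have hz : 1 ≤ α * k + α := by
    have := (inv_le_iff_one_le_mul₀' hα).1 hk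
    linarith
  have hG := rpow_mul_exp_neg_le_Gamma hR0.le hz
  have hGpos : 0 < Real.Gamma (α * k + α) := Real.Gamma_pos_of_pos (by linarith)
  rw [norm_of_nonneg (by positivity)]
  calc ρ ^ k * (Real.Gamma (α * k + α))⁻¹
      ≤ ρ ^ k * (R ^ (α * k + α - 1) * rexp (-R))⁻¹ := by gcongr
    _ = _ := by
      have : R ^ (α * k + α - 1) = (2 * ρ) ^ k * (R ^ (1 - α))⁻¹ := by
        rw [add_sub_assoc, rpow_add hR0, rpow_mul hR0.le, hRα, rpow_natCast, ← rpow_neg hR0.le]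
        ring_nf
      rw [this, Real.exp_neg, mul_pow, one_div, inv_pow]
      field_simp

lemma differentiable_tsum_pow_mul_inv_Gamma {α : ℝ} (hα : 0 < α) :
    Differentiable ℂ fun c : ℂ ↦
      ∑' k : ℕ, (-c) ^ k * (((Real.Gamma (α * k + α))⁻¹ : ℝ) : ℂ) := by
  intro c
  have hρ : 0 < ‖c‖ + 1 := by positivity
  refine (Complex.differentiableOn_tsum_of_summable_norm (U := Metric.ball 0 (‖c‖ + 1))
    (summable_pow_mul_inv_Gamma hα hρ) (fun k ↦ ?_) Metric.isOpen_ball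
    fun k w hw ↦ ?_).differentiableAt (Metric.isOpen_ball.mem_nhds (by simp))
  · fun_prop
  · have : 0 < Real.Gamma (α * k + α) := Real.Gamma_pos_of_pos (by positivity)
    rw [norm_mul, norm_pow, norm_neg, norm_real, norm_of_nonneg (by positivity)]
    have := (mem_ball_zero_iff.1 hw).le
    gcongr

lemma tsum_eq_integral_mittagLefflerKernel {α : ℝ} (hα : α ∈ Set.Ioc (0 : ℝ) 1) {c : ℂ}
    (hc : 0 < c.re) :
    ∑' k : ℕ, (-c) ^ k * (((Real.Gamma (α * k + α))⁻¹ : ℝ) : ℂ) =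
      ∫ w, mittagLefflerKernel α c w := by
  have hU : IsOpen {ζ : ℂ | 0 < ζ.re} := isOpen_lt continuous_const continuous_re
  have hev : (fun c : ℂ ↦ ∑' k : ℕ, (-c) ^ k * (((Real.Gamma (α * k + α))⁻¹ : ℝ) : ℂ)) =ᶠ[𝓝 (1 / 2)]
      fun c ↦ ∫ w, mittagLefflerKernel α c w := by
    filter_upwards [Metric.isOpen_ball.mem_nhds
      (show (1 / 2 : ℂ) ∈ Metric.ball 0 1 by simp; norm_num)] with c hc
    exact (integral_mittagLefflerKernel_eq_tsum hα.1 (mem_ball_zero_iff.1 hc)).symm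
  exact ((differentiable_tsum_pow_mul_inv_Gamma hα.1).differentiableOn.analyticOnNhd
    hU).eqOn_of_preconnected_of_eventuallyEq
    ((differentiableOn_integral_mittagLefflerKernel ⟨hα.1.le, hα.2⟩).analyticOnNhd hU)
    (convex_halfSpace_re_gt 0).isPreconnected (by simp) hev hc

/-- For `α ∈ (0,1)` there exists `C > 0` with `|E_{α,α}(τ)| ≤ C τ^{-2}` for
every `τ ≤ -1`. -/
theorem stmt9 (α : ℝ) (hα : α ∈ Set.Ioo (0 : ℝ) 1)
    (E : ℝ → ℝ) (hE : ∀ x : ℝ, E x = ∑' k : ℕ, x ^ k * (Real.Gamma (α * k + α))⁻¹) :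
    ∃ C > 0, ∀ τ : ℝ, τ ≤ -1 → |E τ| ≤ C / τ ^ 2 := by
  obtain ⟨h0, h1⟩ := hα
  have hs := integrable_norm_rpow_vertical (p := α - 2) (by linarith)
  set J := ∫ w : ℝ, ‖(1 + 2 * π * w * I : ℂ)‖ ^ (α - 2)
  have hJ : 0 ≤ J := by positivity
  have hA : 0 ≤ α * (1 - α) + 2 * α ^ 2 := by nlinarith
  refine ⟨rexp 1 * (α * (1 - α) + 2 * α ^ 2) * J + 1, by positivity, fun τ hτ ↦ ?_⟩
  have hpos : 0 < -τ := by linarith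
  have hEτ : (E τ : ℂ) = ∫ w, mittagLefflerKernel α (-τ : ℝ) w := by
    rw [← tsum_eq_integral_mittagLefflerKernel ⟨h0, h1.le⟩ (by simpa using hpos), hE]
    push_cast
    simp
  rw [← norm_eq_abs, ← norm_real, hEτ]
  calc ‖∫ w, mittagLefflerKernel α (-τ : ℝ) w‖
      ≤ ∫ w : ℝ, rexp 1 * (α * (1 - α) + 2 * α ^ 2) * ‖(1 + 2 * π * w * I : ℂ)‖ ^ (α - 2) /
          (-τ) ^ 2 :=
        norm_integral_le_of_norm_le ((hs.const_mul _).div_const _)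
          (ae_of_all _ fun w ↦ norm_mittagLefflerKernel_le ⟨h0.le, h1.le⟩ w hpos)
    _ = rexp 1 * (α * (1 - α) + 2 * α ^ 2) * J / τ ^ 2 := by
        rw [integral_div, integral_const_mul, neg_sq]
    _ ≤ _ := by
        gcongr
        linarith
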